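/- (Ky Fan's theorem, lower-bound direction, as used in Eq. (3)) Let A ∈ ℝ^{n×n} be a symmetric matrix with eigenvalues σ_1 ≤ σ_2 ≤ … ≤ σ_n listed with multiplicity. For every k ≤ n and every matrix F ∈ ℝ^{n×k} with orthonormal columns (F^T F = I_k), one has Tr(F^T A F) ≥ σ_1 + σ_2 + … + σ_k. -/

import Mathlib

open Matrix BigOperators

theorem diag_mul_transpose_le_one {ι κ : Type*} [Fintype ι] [Fintype κ] [DecidableEq κ]
    (G : Matrix ι κ ℝ) (hG : Gᵀ * G = 1) (i : ι) : (G * Gᵀ) i i ≤ 1 := by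
  have hidem : (G * Gᵀ) * (G * Gᵀ)ᵀ = G * Gᵀ := by
    rw [transpose_mul, transpose_transpose, Matrix.mul_assoc, ← Matrix.mul_assoc Gᵀ, hG,
      Matrix.one_mul]
  have hsum : ∑ j, (G * Gᵀ) i j * (G * Gᵀ) i j = (G * Gᵀ) i i := by
    conv_rhs => rw [← hidem]
    rfl
  have hle : (G * Gᵀ) i i * (G * Gᵀ) i i ≤ (G * Gᵀ) i i := by
    conv_rhs => rw [← hsum]
    exact Finset.single_le_sum (f := fun j => (G * Gᵀ) i j * (G * Gᵀ) i j)
      (fun j _ => mul_self_nonneg _) (Finset.mem_univ i)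
  nlinarith

theorem sum_castLE_le_sum_mul {n k : ℕ} (hk : k ≤ n) (σ w : Fin n → ℝ) (hmono : Monotone σ)
    (hw₀ : ∀ i, 0 ≤ w i) (hw₁ : ∀ i, w i ≤ 1) (hsum : ∑ i, w i = k) :
    ∑ i : Fin k, σ (Fin.castLE hk i) ≤ ∑ i, σ i * w i := by
  obtain ⟨m, rfl⟩ := Nat.exists_eq_add_of_le hk
  obtain ⟨c, hc₁, hc₂⟩ : ∃ c, (∀ i : Fin k, σ (Fin.castAdd m i) ≤ c) ∧
      ∀ j : Fin m, c ≤ σ (Fin.natAdd k j) := by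
    rcases m with _ | m
    · rcases k with _ | k
      · exact ⟨0, fun i => i.elim0, fun j => j.elim0⟩
      · exact ⟨σ (Fin.last k), fun i => hmono (Fin.le_last _), fun j => j.elim0⟩
    · refine ⟨σ (Fin.natAdd k 0), fun i => hmono ?_, fun j => hmono ?_⟩ <;>
        simp only [Fin.le_def, Fin.val_castAdd, Fin.val_natAdd, Fin.val_zero] <;> omega
  rw [Fin.sum_univ_add] at hsum ⊢
  have hhead : ∑ i : Fin k, (σ (Fin.castAdd m i) - c) ≤
      ∑ i : Fin k, (σ (Fin.castAdd m i) - c) * w (Fin.castAdd m i) :=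
    Finset.sum_le_sum fun i _ => by nlinarith [hc₁ i, hw₁ (Fin.castAdd m i)]
  have htail : 0 ≤ ∑ j : Fin m, (σ (Fin.natAdd k j) - c) * w (Fin.natAdd k j) :=
    Finset.sum_nonneg fun j _ => mul_nonneg (sub_nonneg.2 (hc₂ j)) (hw₀ _)
  simp only [sub_mul, Finset.sum_sub_distrib, ← Finset.mul_sum, Finset.sum_const,
    Finset.card_univ, Fintype.card_fin, nsmul_eq_mul] at hhead htail
  have hcast : ∑ i : Fin k, σ (Fin.castLE hk i) = ∑ i : Fin k, σ (Fin.castAdd m i) := rfl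
  rw [hcast]
  linear_combination hhead + htail - c * hsum

theorem trace_transpose_mul_diagonal_mul {ι κ : Type*} [Fintype ι] [DecidableEq ι] [Fintype κ]
    (G : Matrix ι κ ℝ) (d : ι → ℝ) :
    (Gᵀ * diagonal d * G).trace = ∑ i, d i * (G * Gᵀ) i i := by
  rw [Matrix.mul_assoc, trace_mul_comm, Matrix.mul_assoc]
  simp [trace, diagonal_mul]

theorem kyFan_lower_bound {n k : ℕ} (hk : k ≤ n)
    (A : Matrix (Fin n) (Fin n) ℝ) (hA : A.IsHermitian)
    (σ : Fin n → ℝ) (hmono : Monotone σ)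
    (e : Fin n ≃ Fin n) (hσ : σ = hA.eigenvalues ∘ e)
    (F : Matrix (Fin n) (Fin k) ℝ) (hF : Fᵀ * F = 1) :
    ∑ i : Fin k, σ (Fin.castLE hk i) ≤ (Fᵀ * A * F).trace := by
  obtain ⟨U, hU, hAU⟩ : ∃ U : Matrix (Fin n) (Fin n) ℝ,
      U * Uᵀ = 1 ∧ A = U * diagonal hA.eigenvalues * Uᵀ := by
    refine ⟨hA.eigenvectorUnitary, ?_, ?_⟩
    · simpa [star_eq_conjTranspose] using Unitary.coe_mul_star_self hA.eigenvectorUnitary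
    · simpa [Unitary.conjStarAlgAut_apply, star_eq_conjTranspose, Function.comp_def]
        using hA.spectral_theorem
  set G := Uᵀ * F with hGdef
  have hG : Gᵀ * G = 1 := by
    rw [hGdef, transpose_mul, transpose_transpose, Matrix.mul_assoc, ← Matrix.mul_assoc U, hU,
      Matrix.one_mul, hF]
  have htrace : (Fᵀ * A * F).trace = ∑ i, σ i * (G * Gᵀ) (e i) (e i) := by
    have hFG : Fᵀ * A * F = Gᵀ * diagonal hA.eigenvalues * G := by
      conv_lhs => rw [hAU]
      simp only [hGdef, transpose_mul, transpose_transpose, Matrix.mul_assoc]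
    rw [hFG, trace_transpose_mul_diagonal_mul, ← e.sum_comp, hσ]
    rfl
  rw [htrace]
  refine sum_castLE_le_sum_mul hk σ _ hmono (fun i => ?_)
    (fun i => diag_mul_transpose_le_one G hG (e i)) ?_
  · rw [mul_apply]
    exact Finset.sum_nonneg fun j _ => mul_self_nonneg (G (e i) j)
  · rw [e.sum_comp fun i => (G * Gᵀ) i i]
    change (G * Gᵀ).trace = k
    rw [trace_mul_comm, hG, trace_one, Fintype.card_fin]
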